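/- arXiv:1407.5189 — 4 statements merged into one kernel-verified Lean document; each statement's English description precedes it below -/
import Mathlib

section
/- Let k ≥ 1 be an integer and κ₀ ≥ 1. Let r be a real polynomial of degree at most k with r(0) = 1 satisfying condition (i): |r(λ)| ≤ κ₀ for all λ ∈ [0,1]. Let g be the polynomial determined by r(λ) = 1 − λ·g(λ). Then sup_{λ ∈ [0,1]} |g(λ)| ≤ 2κ₀k². -/
open Polynomial Polynomial.Chebyshev in
/-- Lagrange interpolation at the Chebyshev nodes, applied to the difference `P(1) - P(x)`. -/
lemma sumNodes_lagrange_sub {n : ℕ} {P : ℝ[X]} (hP : P.degree ≤ n) (x : ℝ) :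
    sumNodes n (fun i => (∏ j ∈ (Finset.range (n + 1)).erase i, (node n i - node n j))⁻¹ *
      (∏ j ∈ (Finset.range (n + 1)).erase i, (1 - node n j) -
        ∏ j ∈ (Finset.range (n + 1)).erase i, (x - node n j))) P = P.eval 1 - P.eval x := by
  have hlt : P.degree < (Finset.range (n + 1)).card := by
    rw [Finset.card_range]
    exact lt_of_le_of_lt hP (by norm_cast; simp)
  have key (y : ℝ) : P.eval y = ∑ i ∈ Finset.range (n + 1), P.eval (node n i) *
      ((∏ j ∈ (Finset.range (n + 1)).erase i, (node n i - node n j))⁻¹ *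
        ∏ j ∈ (Finset.range (n + 1)).erase i, (y - node n j)) := by
    conv_lhs => rw [Lagrange.eq_interpolate (strictAntiOn_node n).injOn hlt]
    rw [Lagrange.interpolate_eq_sum, eval_finsetSum]
    refine Finset.sum_congr rfl fun i _ => ?_
    simp only [eval_mul, eval_C, eval_prod, eval_sub, eval_X]
    ring
  rw [key 1, key x, ← Finset.sum_sub_distrib, sumNodes, ← Nat.range_succ_eq_Iic]
  exact Finset.sum_congr rfl fun i _ => by ring

open Polynomial Polynomial.Chebyshev in
/-- Near the endpoint `1`, Chebyshev polynomials have the largest drop from their value at `1`. -/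
lemma eval_one_sub_eval_le_one_sub_T {n : ℕ} (hn : 1 ≤ n) {P : ℝ[X]} (hP : P.degree ≤ n)
    (hPbnd : ∀ x ∈ Set.Icc (-1) 1, |P.eval x| ≤ 1) {x : ℝ} (hx : node n 1 ≤ x) (hx1 : x ≤ 1) :
    P.eval 1 - P.eval x ≤ 1 - (T ℝ n).eval x := by
  have hT : (T ℝ n).eval 1 = 1 := by simp
  have hge {j : ℕ} (hj : j ∈ Finset.range (n + 1)) (hj0 : j ≠ 0) : 0 ≤ x - node n j := by
    have : node n j ≤ node n 1 := (strictAntiOn_node n).antitoneOn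
      (by simp; omega) (by simpa using hj) (by omega)
    linarith
  rw [← sumNodes_lagrange_sub hP x]
  nth_rewrite 2 [← hT]
  rw [← sumNodes_lagrange_sub (n := n) (P := T ℝ n) (by simp) x]
  refine sumNodes_le_sumNodes_T (fun i hi => ?_) hPbnd
  have hw := (inv_pos_of_pos (zero_lt_prod_node_sub_node hi)).le
  rw [mul_inv, ← inv_pow, inv_neg_one] at hw
  rw [← mul_assoc]
  refine mul_nonneg hw (sub_nonneg.mpr ?_)
  rcases eq_or_ne i 0 with rfl | hi0
  · exact Finset.prod_le_prod
      (fun j hj => hge (Finset.mem_of_mem_erase hj) (Finset.ne_of_mem_erase hj))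
      (fun j _ => by linarith)
  · have h0 : 0 ∈ (Finset.range (n + 1)).erase i := by simp [hi0.symm]
    rw [← Finset.mul_prod_erase _ _ h0, ← Finset.mul_prod_erase _ (fun j => 1 - node n j) h0,
      node_eq_one, sub_self, zero_mul]
    refine mul_nonpos_of_nonpos_of_nonneg (by linarith) (Finset.prod_nonneg fun j hj => ?_)
    exact hge (Finset.mem_of_mem_erase (Finset.mem_of_mem_erase hj)) (Finset.ne_of_mem_erase hj)

lemma abs_sin_nat_mul_le (n : ℕ) (a : ℝ) : |Real.sin (n * a)| ≤ n * |Real.sin a| := by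
  induction n with
  | zero => simp
  | succ n ih =>
    rw [Nat.cast_succ, add_mul, one_mul, Real.sin_add]
    calc _ ≤ |Real.sin (n * a)| * |Real.cos a| + |Real.cos (n * a)| * |Real.sin a| := by
          simpa only [abs_mul] using abs_add_le (Real.sin (n * a) * Real.cos a)
            (Real.cos (n * a) * Real.sin a)
      _ ≤ |Real.sin (n * a)| * 1 + 1 * |Real.sin a| := by
          gcongr <;> exact Real.abs_cos_le_one _
      _ ≤ _ := by linarith

lemma one_sub_cos_nat_mul_le (n : ℕ) (θ : ℝ) :
    1 - Real.cos (n * θ) ≤ n ^ 2 * (1 - Real.cos θ) := by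
  have half (t : ℝ) : 1 - Real.cos t = 2 * |Real.sin (t / 2)| ^ 2 := by
    rw [sq_abs, Real.sin_sq_eq_half_sub, mul_div_cancel₀ t two_ne_zero]
    ring
  have h := pow_le_pow_left₀ (abs_nonneg _) (abs_sin_nat_mul_le n (θ / 2)) 2
  rw [half, half, mul_div_assoc]
  rw [mul_pow] at h
  linarith

open Polynomial Polynomial.Chebyshev in
lemma one_sub_eval_T_le (n : ℕ) {x : ℝ} (hx : x ∈ Set.Icc (-1) 1) :
    1 - (T ℝ n).eval x ≤ n ^ 2 * (1 - x) := by
  rw [← Real.cos_arccos hx.1 hx.2, T_real_cos]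
  exact_mod_cast one_sub_cos_nat_mul_le n _

open Polynomial.Chebyshev in
lemma two_le_sq_mul_one_sub_node {n : ℕ} (hn : 1 ≤ n) : 2 ≤ (n : ℝ) ^ 2 * (1 - node n 1) := by
  have hn' : (1 : ℝ) ≤ n := mod_cast hn
  have hpos : (0 : ℝ) < n := by linarith
  have hs : 2 / Real.pi * (Real.pi / n / 2) ≤ Real.sin (Real.pi / n / 2) := by
    refine Real.mul_le_sin (by positivity) ?_
    gcongr
    exact div_le_self Real.pi_pos.le hn'
  have e : 2 / Real.pi * (Real.pi / n / 2) = 1 / n := by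
    field_simp
  rw [e, div_le_iff₀ hpos] at hs
  have hc : 1 - node n 1 = 2 * Real.sin (Real.pi / n / 2) ^ 2 := by
    rw [node, Real.sin_sq_eq_half_sub, mul_div_cancel₀ _ two_ne_zero, Nat.cast_one, one_mul]
    ring
  rw [hc]
  nlinarith

open Polynomial Polynomial.Chebyshev in
/-- A divided-difference form of the Markov brothers' inequality at the endpoint `1`. -/
lemma abs_eval_one_sub_eval_le {n : ℕ} (hn : 1 ≤ n) {P : ℝ[X]} (hP : P.degree ≤ n)
    (hPbnd : ∀ x ∈ Set.Icc (-1) 1, |P.eval x| ≤ 1) {x : ℝ} (hx : x ∈ Set.Icc (-1) 1) :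
    |P.eval 1 - P.eval x| ≤ n ^ 2 * (1 - x) := by
  rcases le_total (node n 1) x with h | h
  · have h1 := eval_one_sub_eval_le_one_sub_T hn hP hPbnd h hx.2
    have h2 := eval_one_sub_eval_le_one_sub_T hn (P := -P) (by simpa using hP)
      (by simpa using hPbnd) h hx.2
    have h3 := one_sub_eval_T_le n hx
    simp only [eval_neg] at h2
    exact abs_le.mpr ⟨by linarith, by linarith⟩
  · calc |P.eval 1 - P.eval x| ≤ |P.eval 1| + |P.eval x| := abs_sub _ _
      _ ≤ 2 := by linarith [hPbnd 1 (by norm_num), hPbnd x hx]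
      _ ≤ n ^ 2 * (1 - node n 1) := two_le_sq_mul_one_sub_node hn
      _ ≤ _ := by gcongr

open Polynomial in
/-- The inequality `abs_eval_one_sub_eval_le` transported to the interval `[0, 1]`. -/
lemma abs_eval_zero_sub_eval_le {n : ℕ} (hn : 1 ≤ n) {κ : ℝ} (hκ : 0 < κ) {r : ℝ[X]}
    (hr : r.natDegree ≤ n) (hbnd : ∀ x ∈ Set.Icc (0 : ℝ) 1, |r.eval x| ≤ κ)
    {x : ℝ} (hx : x ∈ Set.Icc (0 : ℝ) 1) :
    |r.eval 0 - r.eval x| ≤ 2 * κ * n ^ 2 * x := by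
  set P : ℝ[X] := C κ⁻¹ * r.comp (C (1 / 2) - C (1 / 2) * X) with hPdef
  have hev (y : ℝ) : P.eval y = κ⁻¹ * r.eval (1 / 2 - 1 / 2 * y) := by simp [hPdef]
  have hdeg : P.degree ≤ n := by
    refine natDegree_le_iff_degree_le.mp ((natDegree_C_mul_le _ _).trans ?_)
    rw [natDegree_comp]
    refine (Nat.mul_le_mul hr (?_ : _ ≤ 1)).trans (by simp)
    compute_degree
  have hPbnd : ∀ y ∈ Set.Icc (-1 : ℝ) 1, |P.eval y| ≤ 1 := by
    intro y hy
    rw [hev, abs_mul, abs_inv, abs_of_pos hκ, inv_mul_le_one₀ hκ]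
    exact hbnd _ ⟨by linarith [hy.2], by linarith [hy.1]⟩
  have h := abs_eval_one_sub_eval_le hn hdeg hPbnd (x := 1 - 2 * x)
    ⟨by linarith [hx.2], by linarith [hx.1]⟩
  rw [hev, hev, ← mul_sub, abs_mul, abs_inv, abs_of_pos hκ, inv_mul_le_iff₀ hκ] at h
  rw [show (1 / 2 - 1 / 2 * 1 : ℝ) = 0 by norm_num,
    show 1 / 2 - 1 / 2 * (1 - 2 * x) = x by ring] at h
  linarith

theorem stmt_0 (k : ℕ) (hk : 1 ≤ k) (κ₀ : ℝ) (hκ₀ : 1 ≤ κ₀)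
    (r g : Polynomial ℝ) (hdeg : r.natDegree ≤ k) (hr0 : r.eval 0 = 1)
    (hrg : ∀ x : ℝ, r.eval x = 1 - x * g.eval x)
    (hi : ∀ x ∈ Set.Icc (0:ℝ) 1, |r.eval x| ≤ κ₀) :
    ∀ x ∈ Set.Icc (0:ℝ) 1, |g.eval x| ≤ 2 * κ₀ * (k : ℝ) ^ 2 := by
  have hIoc : Set.Ioc (0 : ℝ) 1 ⊆ {x | |g.eval x| ≤ 2 * κ₀ * (k : ℝ) ^ 2} := by
    intro x hx
    have h := abs_eval_zero_sub_eval_le hk (by linarith) hdeg hi ⟨hx.1.le, hx.2⟩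
    rw [hr0, hrg x, sub_sub_cancel, abs_mul, abs_of_pos hx.1, mul_comm] at h
    exact le_of_mul_le_mul_right h hx.1
  have hclosed : IsClosed {x : ℝ | |g.eval x| ≤ 2 * κ₀ * (k : ℝ) ^ 2} :=
    isClosed_le g.continuous.abs continuous_const
  have hsub := hclosed.closure_subset_iff.mpr hIoc
  rw [closure_Ioc zero_ne_one] at hsub
  exact fun x hx => hsub hx
end

section
/- Let k ≥ 1 be an integer and κ₂ > 0. Let r be a real polynomial of degree at most k satisfying condition (ii)₂: |λ·r(λ)| ≤ κ₂/(k+1)² for all λ ∈ [0,1]. Then |λ·r(λ) − τ·r(τ)| ≤ 2κ₂·|λ − τ| for all λ, τ ∈ [0,1]. -/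
open Polynomial Polynomial.Chebyshev

/-- The zeros of the Chebyshev polynomial `T n`, in decreasing order. -/
noncomputable def chebyshevZero (n i : ℕ) : ℝ := Real.cos ((2 * i + 1) * Real.pi / (2 * n))

lemma chebyshevZero_angle_mem {n i : ℕ} (hi : i < n) :
    (2 * i + 1) * Real.pi / (2 * n) ∈ Set.Ioo 0 Real.pi := by
  have hn : (0 : ℝ) < n := by exact_mod_cast (Nat.zero_le i).trans_lt hi
  have hi' : (i : ℝ) + 1 ≤ n := by exact_mod_cast hi
  refine ⟨by positivity, ?_⟩
  rw [div_lt_iff₀ (by positivity)]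
  nlinarith [Real.pi_pos]

lemma chebyshevZero_lt {n i j : ℕ} (hj : j < n) (hij : i < j) :
    chebyshevZero n j < chebyshevZero n i := by
  have hn : (0 : ℝ) < n := by exact_mod_cast (Nat.zero_le j).trans_lt hj
  refine Real.strictAntiOn_cos
    (Set.Ioo_subset_Icc_self (chebyshevZero_angle_mem (hij.trans hj)))
    (Set.Ioo_subset_Icc_self (chebyshevZero_angle_mem hj)) ?_
  have : (i : ℝ) < j := by exact_mod_cast hij
  gcongr

lemma chebyshevZero_injOn (n : ℕ) :
    Set.InjOn (chebyshevZero n) (Finset.range n : Set ℕ) := by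
  intro i hi j hj h
  simp only [Finset.coe_range, Set.mem_Iio] at hi hj
  rcases lt_trichotomy i j with hij | hij | hij
  · exact absurd h (chebyshevZero_lt hj hij).ne'
  · exact hij
  · exact absurd h (chebyshevZero_lt hi hij).ne

/-- To the right of all the zeros of `T n`, the Lagrange basis polynomials alternate in sign. -/
lemma neg_one_pow_mul_basis_chebyshevZero_nonneg {n i : ℕ} (hi : i < n) {x : ℝ}
    (hx : chebyshevZero n 0 ≤ x) :
    0 ≤ (-1) ^ i * (Lagrange.basis (Finset.range n) (chebyshevZero n) i).eval x := by
  have hle : ∀ j < n, 0 ≤ x - chebyshevZero n j := by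
    intro j hj
    rcases Nat.eq_zero_or_pos j with rfl | h
    · linarith
    · linarith [chebyshevZero_lt hj h]
  have hsplit : (Finset.range n).erase i = Finset.range i ∪ Finset.Ioo i n := by
    ext j; simp; omega
  have hdisj : Disjoint (Finset.range i) (Finset.Ioo i n) := by
    rw [Finset.disjoint_left]; intro j; simp; omega
  have hcard : (-1 : ℝ) ^ i = ∏ _j ∈ Finset.range i, (-1 : ℝ) := by simp
  rw [Lagrange.basis, eval_prod, hsplit, Finset.prod_union hdisj, ← mul_assoc, hcard,
    ← Finset.prod_mul_distrib]
  simp only [Lagrange.basisDivisor, eval_mul, eval_C, eval_sub, eval_X]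
  refine mul_nonneg (Finset.prod_nonneg fun j hj => ?_) (Finset.prod_nonneg fun j hj => ?_)
  · have hj := Finset.mem_range.mp hj
    have h : (chebyshevZero n i - chebyshevZero n j)⁻¹ ≤ 0 :=
      inv_nonpos.mpr (by linarith [chebyshevZero_lt hi hj])
    nlinarith [mul_nonneg (neg_nonneg.mpr h) (hle j (hj.trans hi))]
  · have hj := Finset.mem_Ioo.mp hj
    have h : 0 ≤ (chebyshevZero n i - chebyshevZero n j)⁻¹ :=
      inv_nonneg.mpr (by linarith [chebyshevZero_lt hj.2 hj.1])
    exact mul_nonneg h (hle j hj.2)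

lemma eval_eq_sum_basis_chebyshevZero {n : ℕ} {q : ℝ[X]} (hq : q.degree < n) (x : ℝ) :
    q.eval x = ∑ i ∈ Finset.range n, q.eval (chebyshevZero n i) *
      (Lagrange.basis (Finset.range n) (chebyshevZero n) i).eval x := by
  conv_lhs => rw [Lagrange.eq_interpolate (chebyshevZero_injOn n)
    (show q.degree < (Finset.range n).card by simpa using hq)]
  simp [Lagrange.interpolate_apply, eval_finsetSum]

lemma eval_U_chebyshevZero_mul_sin {n i : ℕ} (hi : i < n) :
    (U ℝ (n - 1 : ℕ)).eval (chebyshevZero n i) *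
      Real.sin ((2 * i + 1) * Real.pi / (2 * n)) = (-1) ^ i := by
  have hn : (n : ℝ) ≠ 0 := by exact_mod_cast (by omega : n ≠ 0)
  rw [chebyshevZero, U_real_cos, ← Real.cos_nat_mul_pi, ← Real.sin_add_pi_div_two]
  congr 1
  push_cast [Nat.cast_sub (show 1 ≤ n by omega)]
  field_simp
  ring

lemma eval_U_le {n : ℕ} (hn : 1 ≤ n) {x : ℝ} (hx : |x| ≤ 1) :
    (U ℝ (n - 1 : ℕ)).eval x ≤ n := by
  have hn' : (0 : ℝ) < n := by exact_mod_cast hn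
  have h := (abs_le.mp (abs_iterate_derivative_T_real_le n 1 hx)).2
  rw [Function.iterate_one, T_derivative_eq_U] at h
  simp only [eval_mul, U_eval_one, Int.cast_natCast, eval_natCast] at h
  push_cast [Nat.cast_sub hn]
  have := le_of_mul_le_mul_left h hn'
  simpa using this

lemma abs_eval_le_of_chebyshevZero_le {n : ℕ} (hn : 1 ≤ n) {q : ℝ[X]} (hq : q.degree < n)
    {M : ℝ} (hM : ∀ t : ℝ, |Real.sin t * q.eval (Real.cos t)| ≤ M) {x : ℝ}
    (hx : chebyshevZero n 0 ≤ x) (hx1 : x ≤ 1) : |q.eval x| ≤ n * M := by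
  have hM0 : 0 ≤ M := (abs_nonneg _).trans (hM 0)
  have habs : |x| ≤ 1 := abs_le.mpr ⟨(Real.neg_one_le_cos _).trans hx, hx1⟩
  have hU : (U ℝ (n - 1 : ℕ)).degree < n := by
    rw [degree_U_natCast]; exact_mod_cast (by omega : n - 1 < n)
  calc |q.eval x| ≤ ∑ i ∈ Finset.range n, M * ((U ℝ (n - 1 : ℕ)).eval (chebyshevZero n i) *
      (Lagrange.basis (Finset.range n) (chebyshevZero n) i).eval x) := by
        rw [eval_eq_sum_basis_chebyshevZero hq]
        refine (Finset.abs_sum_le_sum_abs _ _).trans (Finset.sum_le_sum fun i hi => ?_)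
        have hi := Finset.mem_range.mp hi
        set l := (Lagrange.basis (Finset.range n) (chebyshevZero n) i).eval x
        have hl : 0 ≤ (-1) ^ i * l := neg_one_pow_mul_basis_chebyshevZero_nonneg hi hx
        have hs := Real.sin_pos_of_mem_Ioo (chebyshevZero_angle_mem hi)
        have hUi := eval_U_chebyshevZero_mul_sin hi
        have hqi := hM ((2 * i + 1) * Real.pi / (2 * n))
        rw [← chebyshevZero, abs_mul, abs_of_pos hs] at hqi
        set s := Real.sin ((2 * i + 1) * Real.pi / (2 * n))
        rw [← eq_div_iff hs.ne'] at hUi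
        rw [← le_div_iff₀' hs] at hqi
        have habsl : |l| = (-1) ^ i * l := by
          rw [← abs_of_nonneg hl, abs_mul, abs_neg_one_pow, one_mul]
        rw [abs_mul, hUi, habsl]
        calc _ ≤ M / s * ((-1) ^ i * l) := by gcongr
          _ = _ := by ring
    _ = M * (U ℝ (n - 1 : ℕ)).eval x := by
        rw [← Finset.mul_sum, ← eval_eq_sum_basis_chebyshevZero hU]
    _ ≤ M * n := by gcongr; exact eval_U_le hn habs
    _ = n * M := mul_comm _ _

/-- **Schur's inequality**. -/
theorem abs_eval_le_of_abs_sin_mul_eval_cos_le {n : ℕ} (hn : 1 ≤ n) {q : ℝ[X]}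
    (hq : q.degree < n) {M : ℝ} (hM : ∀ t : ℝ, |Real.sin t * q.eval (Real.cos t)| ≤ M)
    {x : ℝ} (hx : x ∈ Set.Icc (-1) 1) : |q.eval x| ≤ n * M := by
  have hn' : (1 : ℝ) ≤ n := by exact_mod_cast hn
  rcases le_or_gt (chebyshevZero n 0) x with h | h
  · exact abs_eval_le_of_chebyshevZero_le hn hq hM h hx.2
  rcases le_or_gt (chebyshevZero n 0) (-x) with h' | h'
  · have hdeg : (q.comp (-X)).degree < n := by
      rw [degree_lt_iff_coeff_zero] at hq ⊢
      intro m hm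
      rw [← neg_one_mul (X : ℝ[X]), ← Polynomial.C_1, ← Polynomial.C_neg, comp_C_mul_X_coeff, hq m hm, zero_mul]
    have := abs_eval_le_of_chebyshevZero_le hn hdeg (M := M) (fun t => ?_) h'
      (by linarith [hx.1])
    · simpa using this
    · simpa [Real.cos_pi_sub, Real.sin_pi_sub] using hM (Real.pi - t)
  · have hsin := hM (Real.arccos x)
    rw [Real.cos_arccos hx.1 hx.2, abs_mul, Real.sin_arccos,
      abs_of_nonneg (Real.sqrt_nonneg _)] at hsin
    have hangle : (2 * ((0 : ℕ) : ℝ) + 1) * Real.pi / (2 * n) = Real.pi / (2 * n) := by simp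
    have hjordan : 1 / (n : ℝ) ≤ Real.sin (Real.pi / (2 * n)) := by
      have := Real.mul_le_sin (x := Real.pi / (2 * n)) (by positivity) (by
        apply div_le_div_of_nonneg_left Real.pi_pos.le two_pos; linarith)
      refine le_trans (le_of_eq ?_) this
      field_simp
    have hsq : x ^ 2 ≤ Real.cos (Real.pi / (2 * n)) ^ 2 := by
      rw [chebyshevZero, hangle] at h h'
      exact sq_le_sq' (by linarith) h.le
    have hroot : 1 / (n : ℝ) ≤ √(1 - x ^ 2) := by
      refine hjordan.trans (Real.le_sqrt_of_sq_le ?_)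
      linarith [Real.sin_sq_add_cos_sq (Real.pi / (2 * n))]
    have := (mul_le_mul_of_nonneg_right hroot (abs_nonneg (q.eval x))).trans hsin
    rwa [one_div, inv_mul_le_iff₀ (by positivity)] at this

/-- Splitting `p (cos (α + t))` into its even and odd parts in `t`. -/
lemma exists_eval_cos_add (n : ℕ) (α : ℝ) (p : ℝ[X]) (hp : p.natDegree ≤ n) :
    ∃ A B : ℝ[X], A.degree ≤ n ∧ B.degree < n ∧
      ∀ t : ℝ, p.eval (Real.cos (α + t)) =
        A.eval (Real.cos t) + Real.sin t * B.eval (Real.cos t) := by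
  induction n generalizing p with
  | zero =>
    obtain ⟨c, rfl⟩ : ∃ c, p = C c := ⟨_, eq_C_of_natDegree_le_zero hp⟩
    exact ⟨C c, 0, by simpa using degree_C_le, by simp, by simp⟩
  | succ n ih =>
    obtain ⟨A, B, hA, hB, h⟩ := ih p.divX (by rw [natDegree_divX_eq_natDegree_tsub_one]; omega)
    refine ⟨C (Real.cos α) * X * A - C (Real.sin α) * (1 - X ^ 2) * B + C (p.coeff 0),
      C (Real.cos α) * X * B - C (Real.sin α) * A, ?_, ?_, fun t => ?_⟩
    · rw [degree_le_iff_coeff_zero] at hA ⊢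
      rw [degree_lt_iff_coeff_zero] at hB
      intro m hm
      have hm : n + 1 < m := by exact_mod_cast hm
      obtain ⟨m, rfl⟩ : ∃ k, m = k + 2 := ⟨m - 2, by omega⟩
      have hA' : A.coeff (m + 1) = 0 := hA _ (by exact_mod_cast (by omega))
      have h1 := hB m (by omega)
      have h2 := hB (m + 2) (by omega)
      simp [mul_assoc, sub_mul, coeff_X_mul, coeff_X_pow_mul, hA', h1, h2]
    · rw [degree_le_iff_coeff_zero] at hA
      rw [degree_lt_iff_coeff_zero] at hB ⊢
      intro m hm
      obtain ⟨m, rfl⟩ : ∃ k, m = k + 1 := ⟨m - 1, by omega⟩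
      have hA' : A.coeff (m + 1) = 0 := hA _ (by exact_mod_cast (by omega))
      simp [mul_assoc, coeff_X_mul, hA', hB m (by omega)]
    · conv_lhs => rw [← divX_mul_X_add p]
      simp only [eval_add, eval_sub, eval_mul, eval_C, eval_X, h, eval_pow, eval_one]
      rw [Real.cos_add]
      linear_combination (-Real.sin α * B.eval (Real.cos t)) * Real.sin_sq_add_cos_sq t

/-- **Bernstein's inequality**. -/
theorem abs_sin_mul_eval_derivative_cos_le {n : ℕ} (hn : 1 ≤ n) {p : ℝ[X]}
    (hp : p.natDegree ≤ n) {M : ℝ} (hM : ∀ x ∈ Set.Icc (-1) 1, |p.eval x| ≤ M) (α : ℝ) :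
    |Real.sin α * p.derivative.eval (Real.cos α)| ≤ n * M := by
  obtain ⟨A, B, -, hB, h⟩ := exists_eval_cos_add n α p hp
  have hbound : ∀ t : ℝ, |Real.sin t * B.eval (Real.cos t)| ≤ M := by
    intro t
    have h1 := h t
    have h2 := h (-t)
    rw [Real.cos_neg, Real.sin_neg] at h2
    have b1 := abs_le.mp (hM _ (Real.cos_mem_Icc (α + t)))
    have b2 := abs_le.mp (hM _ (Real.cos_mem_Icc (α + -t)))
    rw [abs_le]
    constructor <;> linarith [b1.1, b1.2, b2.1, b2.2]
  have hderiv : -Real.sin α * p.derivative.eval (Real.cos α) = B.eval 1 := by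
    have hl : HasDerivAt (fun t => p.eval (Real.cos (α + t)))
        (p.derivative.eval (Real.cos (α + 0)) * (-Real.sin (α + 0) * 1)) 0 :=
      (p.hasDerivAt _).comp (0 : ℝ) ((hasDerivAt_id (0 : ℝ)).const_add α).cos
    have hr := ((A.hasDerivAt (Real.cos 0)).comp (0 : ℝ) (Real.hasDerivAt_cos 0)).add
      ((Real.hasDerivAt_sin 0).mul
        ((B.hasDerivAt (Real.cos 0)).comp (0 : ℝ) (Real.hasDerivAt_cos 0)))
    rw [funext h] at hl
    have := hl.unique hr
    simp at this
    linarith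
  have := abs_eval_le_of_abs_sin_mul_eval_cos_le hn hB hbound (x := 1) (by norm_num)
  rwa [← hderiv, neg_mul, abs_neg] at this

/-- **Markov's inequality** on `[-1, 1]`. -/
theorem abs_eval_derivative_le {n : ℕ} (hn : 1 ≤ n) {p : ℝ[X]} (hp : p.natDegree ≤ n) {M : ℝ}
    (hM : ∀ x ∈ Set.Icc (-1) 1, |p.eval x| ≤ M) {x : ℝ} (hx : x ∈ Set.Icc (-1) 1) :
    |p.derivative.eval x| ≤ n ^ 2 * M := by
  have hdeg : p.derivative.degree < n := by
    rw [degree_lt_iff_coeff_zero]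
    intro m hm
    rw [coeff_derivative, coeff_eq_zero_of_natDegree_lt (by omega), zero_mul]
  have := abs_eval_le_of_abs_sin_mul_eval_cos_le hn hdeg
    (abs_sin_mul_eval_derivative_cos_le hn hp hM) hx
  linarith

/-- **Markov's inequality** on `[0, 1]`. -/
theorem abs_eval_derivative_le_of_unitInterval {n : ℕ} (hn : 1 ≤ n) {p : ℝ[X]}
    (hp : p.natDegree ≤ n) {M : ℝ} (hM : ∀ x ∈ Set.Icc (0 : ℝ) 1, |p.eval x| ≤ M) {x : ℝ}
    (hx : x ∈ Set.Icc (0 : ℝ) 1) : |p.derivative.eval x| ≤ 2 * n ^ 2 * M := by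
  set q : ℝ[X] := p.comp (C 2⁻¹ * X + C 2⁻¹) with hq
  have hqdeg : q.natDegree ≤ n := by
    rw [hq, natDegree_comp]
    exact (Nat.mul_le_mul_left _ natDegree_linear_le).trans (by simpa using hp)
  have hqM : ∀ y ∈ Set.Icc (-1 : ℝ) 1, |q.eval y| ≤ M := by
    intro y hy
    simp only [hq, eval_comp, eval_add, eval_mul, eval_C, eval_X]
    exact hM _ ⟨by linarith [hy.1], by linarith [hy.2]⟩
  have h := abs_eval_derivative_le hn hqdeg hqM (x := 2 * x - 1)
    ⟨by linarith [hx.1], by linarith [hx.2]⟩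
  have hpt : 2⁻¹ * (2 * x - 1) + 2⁻¹ = x := by ring
  simp only [hq, derivative_comp, derivative_add, derivative_mul, derivative_C, derivative_X,
    eval_mul, eval_comp, eval_add, eval_C, eval_X, hpt] at h
  simp [abs_mul] at h
  linarith

theorem stmt_3 (k : ℕ) (hk : 1 ≤ k) (κ₂ : ℝ) (hκ₂ : 0 < κ₂)
    (r : Polynomial ℝ) (hdeg : r.natDegree ≤ k)
    (hii : ∀ x ∈ Set.Icc (0:ℝ) 1, |x * r.eval x| ≤ κ₂ / ((k : ℝ) + 1) ^ 2) :
    ∀ x ∈ Set.Icc (0:ℝ) 1, ∀ τ ∈ Set.Icc (0:ℝ) 1,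
      |x * r.eval x - τ * r.eval τ| ≤ 2 * κ₂ * |x - τ| := by
  intro x hx τ hτ
  have hp : (X * r).natDegree ≤ k + 1 := by
    refine natDegree_mul_le.trans ?_
    rw [natDegree_X]
    omega
  have hderiv : ∀ y ∈ Set.Icc (0 : ℝ) 1, ‖(X * r).derivative.eval y‖ ≤ 2 * κ₂ := by
    intro y hy
    refine (abs_eval_derivative_le_of_unitInterval (Nat.le_add_left 1 k) hp
      (by simpa using hii) hy).trans_eq ?_
    push_cast
    field_simp
  have h : |(X * r).eval x - (X * r).eval τ| ≤ 2 * κ₂ * |x - τ| :=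
    (convex_Icc (0 : ℝ) 1).norm_image_sub_le_of_norm_hasDerivWithin_le
      (fun y _ => ((X * r).hasDerivAt y).hasDerivWithinAt) hderiv hτ hx
  simpa using h
end

section
/- Let k ≥ 1 be an integer, κ₀ ≥ 1 and κ₂ > 0. Let r be a real polynomial of degree at most k satisfying condition (i): |r(λ)| ≤ κ₀ for all λ ∈ [0,1], and condition (ii)₂: |λ·r(λ)| ≤ κ₂/(k+1)² for all λ ∈ [0,1]. Then √λ·|r(λ) − r(τ)| ≤ 2κ₀·√(1/2 + κ₂/κ₀)·k·|λ − τ| for all λ, τ ∈ [0,1]. -/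
open Polynomial in
/-- If `q` is dominated by `K * N'` at the nodes, where `N` is the nodal polynomial, then
it is dominated by `K * N'` to the right of all nodes. -/
lemma abs_eval_le_mul_derivative_nodal (s : Finset ℝ) {q : ℝ[X]} (hq : q.degree < s.card) {K x : ℝ}
    (hK : ∀ v ∈ s, |q.eval v| ≤ K * |(derivative (Lagrange.nodal s id)).eval v|)
    (hx : ∀ v ∈ s, v ≤ x) :
    |q.eval x| ≤ K * (derivative (Lagrange.nodal s id)).eval x := by
  have hinj : Set.InjOn (id : ℝ → ℝ) s := Function.injective_id.injOn
  have hqx : q.eval x = ∑ v ∈ s, q.eval v / (derivative (Lagrange.nodal s id)).eval v *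
      (Lagrange.nodal (s.erase v) id).eval x := by
    conv_lhs => rw [Lagrange.eq_interpolate hinj hq, Lagrange.interpolate_eq_sum]
    rw [eval_finsetSum]
    refine Finset.sum_congr rfl fun v hv => ?_
    have h := Lagrange.eval_nodal_derivative_eval_node_eq (v := id) hv
    simp only [id] at h
    rw [h]
    simp [Lagrange.eval_nodal, eval_prod]
  rw [hqx, Lagrange.derivative_nodal, eval_finsetSum, Finset.mul_sum]
  refine (Finset.abs_sum_le_sum_abs _ _).trans (Finset.sum_le_sum fun v hv => ?_)
  have hnonneg : 0 ≤ (Lagrange.nodal (s.erase v) id).eval x := by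
    rw [Lagrange.eval_nodal]
    exact Finset.prod_nonneg fun w hw => sub_nonneg.2 (hx w (Finset.mem_of_mem_erase hw))
  have hne : (derivative (Lagrange.nodal s id)).eval v ≠ 0 := by
    have h := Lagrange.eval_nodal_derivative_eval_node_eq (v := id) hv
    simp only [id] at h
    rw [h, Lagrange.eval_nodal]
    exact Finset.prod_ne_zero_iff.2 fun w hw => sub_ne_zero.2 (Finset.ne_of_mem_erase hw).symm
  rw [abs_mul, abs_div, abs_of_nonneg hnonneg, ← Lagrange.derivative_nodal]
  gcongr
  rw [div_le_iff₀ (abs_pos.2 hne)]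
  exact hK v hv

open Polynomial in
lemma sin_mul_eval_derivative_T_cos (n : ℕ) (θ : ℝ) :
    (derivative (Chebyshev.T ℝ n)).eval (Real.cos θ) * Real.sin θ = n * Real.sin (n * θ) := by
  have h := Chebyshev.U_real_cos θ ((n : ℤ) - 1)
  rw [Chebyshev.T_derivative_eq_U, eval_mul, mul_assoc, h]
  simp

open Polynomial in
lemma abs_eval_derivative_T_le (n : ℕ) {x : ℝ} (hx : |x| ≤ 1) :
    |(derivative (Chebyshev.T ℝ n)).eval x| ≤ (n : ℝ) ^ 2 := by
  have h := Chebyshev.abs_iterate_derivative_T_real_le n 1 hx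
  refine h.trans (le_of_eq ?_)
  simp [Chebyshev.T_derivative_eq_U]
  ring

open Polynomial in
/-- Schur's inequality near the right endpoint. -/
lemma abs_eval_le_of_abs_eval_cos_mul_sin_le_of_nonneg {n : ℕ} (hn : 0 < n) {q : ℝ[X]}
    (hq : q.natDegree < n) {M : ℝ} (hM : ∀ θ, |q.eval (Real.cos θ) * Real.sin θ| ≤ M) {x : ℝ}
    (hx0 : 0 ≤ x) (hx1 : x ≤ 1) : |q.eval x| ≤ M * n := by
  have hM0 : 0 ≤ M := (abs_nonneg _).trans (hM 0)
  have hn' : (0 : ℝ) < n := Nat.cast_pos.2 hn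
  have hn1 : (1 : ℝ) ≤ n := Nat.one_le_cast.2 hn
  have hpi := Real.pi_pos
  set α : ℝ := Real.pi / (2 * n) with hα
  have hα0 : 0 < α := by positivity
  have hnα : n * α = Real.pi / 2 := by rw [hα]; field_simp
  have hα1 : α ≤ Real.pi / 2 := by nlinarith
  rcases le_total x (Real.cos α) with hxα | hxα
  · have hθα : α ≤ Real.arccos x := by
      rw [← Real.arccos_cos hα0.le (by linarith)]
      exact Real.arccos_le_arccos hxα
    have hθ1 : Real.arccos x ≤ Real.pi / 2 := Real.arccos_le_pi_div_two.2 hx0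
    have hsin : 1 ≤ n * Real.sin (Real.arccos x) := by
      have h1 := Real.mul_le_sin (hα0.le.trans hθα) hθ1
      have h2 : 2 / Real.pi * α ≤ Real.sin (Real.arccos x) := le_trans (by gcongr) h1
      have h3 : n * (2 / Real.pi * α) = 1 := by rw [hα]; field_simp
      nlinarith
    have h := hM (Real.arccos x)
    rw [Real.cos_arccos (by linarith) hx1, abs_mul] at h
    calc |q.eval x| ≤ |q.eval x| * (n * |Real.sin (Real.arccos x)|) :=
          le_mul_of_one_le_right (abs_nonneg _)
            (hsin.trans (mul_le_mul_of_nonneg_left (le_abs_self _) hn'.le))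
      _ = |q.eval x| * |Real.sin (Real.arccos x)| * n := by ring
      _ ≤ M * n := by gcongr
  · set s : Finset ℝ :=
      (Finset.range n).image fun j : ℕ => Real.cos ((2 * j + 1) * Real.pi / (2 * n)) with hs
    have hroots : (Chebyshev.T ℝ n).roots = s.val := Chebyshev.roots_T_real n
    have hcard : s.card = n := by
      rw [hs, Finset.card_image_of_injOn, Finset.card_range]
      exact (Finset.range n).nodup_map_iff_injOn.mp (Chebyshev.roots_T_real_nodup n)
    set c : ℝ := (Chebyshev.T ℝ n).leadingCoeff with hc
    have hc0 : 0 < c := by rw [hc, Chebyshev.leadingCoeff_T]; positivity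
    have hT : C c * Lagrange.nodal s id = Chebyshev.T ℝ n := by
      rw [← C_leadingCoeff_mul_prod_multiset_X_sub_C (p := Chebyshev.T ℝ n), hroots]
      · rfl
      · rw [hroots, Chebyshev.natDegree_T]; simpa using hcard
    have hT' (y : ℝ) : (derivative (Chebyshev.T ℝ n)).eval y =
        c * (derivative (Lagrange.nodal s id)).eval y := by
      rw [← hT]; simp
    have hK : ∀ v ∈ s, |q.eval v| ≤
        (M / n * c) * |(derivative (Lagrange.nodal s id)).eval v| := by
      intro v hv
      have hv0 : (Chebyshev.T ℝ n).eval v = 0 := by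
        rw [← hT, eval_mul]
        simpa using Or.inr (Lagrange.eval_nodal_at_node (v := id) hv)
      obtain ⟨j, -, rfl⟩ := Finset.mem_image.1 hv
      set θ := (2 * (j : ℝ) + 1) * Real.pi / (2 * n)
      have hcos : Real.cos (n * θ) = 0 := by
        have := Chebyshev.T_real_cos θ n
        rw [hv0] at this
        exact_mod_cast this.symm
      have hsin : |Real.sin (n * θ)| = 1 := by
        rw [← sq_eq_sq₀ (abs_nonneg _) zero_le_one, sq_abs]
        nlinarith [Real.sin_sq_add_cos_sq (n * θ)]
      have h := congrArg abs (sin_mul_eval_derivative_T_cos n θ)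
      rw [abs_mul, abs_mul, hsin, Nat.abs_cast, mul_one, hT', abs_mul, abs_of_pos hc0] at h
      have hsθ : 0 < |Real.sin θ| := by
        rcases (abs_nonneg (Real.sin θ)).eq_or_lt with h0 | h0
        · rw [← h0] at h; linarith
        · exact h0
      have h2 := hM θ
      rw [abs_mul] at h2
      refine le_of_mul_le_mul_right ?_ hsθ
      refine h2.trans (le_of_eq ?_)
      rw [mul_assoc, mul_assoc, ← mul_assoc c, h]
      field_simp
    have hxs : ∀ v ∈ s, v ≤ x := by
      intro v hv
      obtain ⟨j, hj, rfl⟩ := Finset.mem_image.1 hv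
      refine le_trans ?_ hxα
      have hj' : (j : ℝ) + 1 ≤ n := by exact_mod_cast Finset.mem_range.1 hj
      apply Real.cos_le_cos_of_nonneg_of_le_pi hα0.le
      · rw [div_le_iff₀ (by positivity)]; nlinarith
      · rw [hα]; gcongr; nlinarith [(Nat.cast_nonneg j : (0 : ℝ) ≤ j)]
    have hdeg : q.degree < s.card := by
      rw [hcard]
      exact degree_le_natDegree.trans_lt (by exact_mod_cast hq)
    calc |q.eval x| ≤ (M / n * c) * (derivative (Lagrange.nodal s id)).eval x :=
          abs_eval_le_mul_derivative_nodal s hdeg hK hxs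
      _ = M / n * (derivative (Chebyshev.T ℝ n)).eval x := by rw [hT']; ring
      _ ≤ M / n * (n : ℝ) ^ 2 := by
          gcongr
          exact (le_abs_self _).trans
            (abs_eval_derivative_T_le n (abs_le.2 ⟨by linarith, hx1⟩))
      _ = M * n := by field_simp

open Polynomial in
/-- Schur's inequality. -/
lemma abs_eval_le_of_abs_eval_cos_mul_sin_le {n : ℕ} (hn : 0 < n) {q : ℝ[X]}
    (hq : q.natDegree < n) {M : ℝ} (hM : ∀ θ, |q.eval (Real.cos θ) * Real.sin θ| ≤ M) {x : ℝ}
    (hx : |x| ≤ 1) : |q.eval x| ≤ M * n := by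
  obtain ⟨hx1, hx2⟩ := abs_le.1 hx
  rcases le_total 0 x with h0 | h0
  · exact abs_eval_le_of_abs_eval_cos_mul_sin_le_of_nonneg hn hq hM h0 hx2
  · have h := abs_eval_le_of_abs_eval_cos_mul_sin_le_of_nonneg (q := q.comp (-X)) hn
      (by simpa [natDegree_comp] using hq) (M := M) (fun θ => ?_) (neg_nonneg.2 h0) (by linarith)
    · simpa using h
    · simpa [Real.cos_pi_sub, Real.sin_pi_sub] using hM (Real.pi - θ)

open Polynomial in
lemma exists_eval_cos_add_eq (p : ℝ[X]) (θ : ℝ) :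
    ∃ A B : ℝ[X], A.natDegree ≤ p.natDegree ∧ B.natDegree ≤ p.natDegree - 1 ∧
      ∀ φ, p.eval (Real.cos (θ + φ)) =
        A.eval (Real.cos φ) + Real.sin φ * B.eval (Real.cos φ) := by
  have hpow (m : ℕ) : ∃ A B : ℝ[X], A.natDegree ≤ m ∧ B.natDegree ≤ m - 1 ∧
      (m = 0 → B = 0) ∧ ∀ φ, Real.cos (θ + φ) ^ m =
        A.eval (Real.cos φ) + Real.sin φ * B.eval (Real.cos φ) := by
    induction m with
    | zero => exact ⟨1, 0, by simp, by simp, by simp, by simp⟩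
    | succ m ih =>
      obtain ⟨A, B, hA, hB, hB0, h⟩ := ih
      refine ⟨C (Real.cos θ) * X * A - C (Real.sin θ) * (1 - X ^ 2) * B,
        C (Real.cos θ) * X * B - C (Real.sin θ) * A, ?_, ?_, by simp, fun φ => ?_⟩
      · rcases Nat.eq_zero_or_pos m with rfl | hm
        · rw [hB0 rfl]
          simp only [mul_zero, sub_zero]
          compute_degree
          omega
        · compute_degree
          omega
      · rcases Nat.eq_zero_or_pos m with rfl | hm
        · rw [hB0 rfl]
          simp only [mul_zero, zero_sub]
          compute_degree
          omega
        · compute_degree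
          omega
      · rw [pow_succ, h, Real.cos_add]
        simp only [eval_sub, eval_mul, eval_C, eval_X, eval_one, eval_pow]
        linear_combination (-Real.sin θ * B.eval (Real.cos φ)) * Real.sin_sq_add_cos_sq φ
  choose A B hA hB _ h using hpow
  refine ⟨∑ i ∈ Finset.range (p.natDegree + 1), C (p.coeff i) * A i,
    ∑ i ∈ Finset.range (p.natDegree + 1), C (p.coeff i) * B i, ?_, ?_, fun φ => ?_⟩
  · refine natDegree_sum_le_of_forall_le _ _ fun i hi => ?_
    have := Finset.mem_range.1 hi
    exact (natDegree_C_mul_le _ _).trans ((hA i).trans (by omega))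
  · refine natDegree_sum_le_of_forall_le _ _ fun i hi => ?_
    have := Finset.mem_range.1 hi
    exact (natDegree_C_mul_le _ _).trans ((hB i).trans (by omega))
  · rw [eval_eq_sum_range, eval_finsetSum, eval_finsetSum, Finset.mul_sum,
      ← Finset.sum_add_distrib]
    refine Finset.sum_congr rfl fun i _ => ?_
    rw [h]
    simp only [eval_mul, eval_C]
    ring

open Polynomial in
/-- Bernstein's inequality. -/
lemma abs_eval_derivative_cos_mul_sin_le {n : ℕ} (hn : 0 < n) {p : ℝ[X]} (hp : p.natDegree ≤ n)
    {M : ℝ} (hM : ∀ x, |x| ≤ 1 → |p.eval x| ≤ M) (θ : ℝ) :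
    |(derivative p).eval (Real.cos θ) * Real.sin θ| ≤ M * n := by
  obtain ⟨A, B, -, hB, h⟩ := exists_eval_cos_add_eq p θ
  have hsub (φ : ℝ) : p.eval (Real.cos (θ + φ)) - p.eval (Real.cos (θ - φ)) =
      2 * (B.eval (Real.cos φ) * Real.sin φ) := by
    rw [sub_eq_add_neg θ, h, h, Real.cos_neg, Real.sin_neg]
    ring
  have hBM (φ : ℝ) : |B.eval (Real.cos φ) * Real.sin φ| ≤ M := by
    have h1 := abs_le.1 (hM _ (Real.abs_cos_le_one (θ + φ)))
    have h2 := abs_le.1 (hM _ (Real.abs_cos_le_one (θ - φ)))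
    have h3 := hsub φ
    exact abs_le.2 ⟨by linarith [h1.1, h2.2], by linarith [h1.2, h2.1]⟩
  have hderiv : (derivative p).eval (Real.cos θ) * Real.sin θ = -B.eval 1 := by
    have d1 : HasDerivAt (fun φ : ℝ => p.eval (Real.cos (θ + φ)))
        ((derivative p).eval (Real.cos (θ + 0)) * (-Real.sin (θ + 0) * 1)) 0 :=
      (p.hasDerivAt _).comp (0 : ℝ) (((hasDerivAt_id (0 : ℝ)).const_add θ).cos)
    have d2 : HasDerivAt (fun φ : ℝ => p.eval (Real.cos (θ - φ)))
        ((derivative p).eval (Real.cos (θ - 0)) * (-Real.sin (θ - 0) * -1)) 0 :=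
      (p.hasDerivAt _).comp (0 : ℝ) (((hasDerivAt_id (0 : ℝ)).const_sub θ).cos)
    have d3 : HasDerivAt (fun φ : ℝ => 2 * (B.eval (Real.cos φ) * Real.sin φ))
        (2 * ((derivative B).eval (Real.cos 0) * (-Real.sin 0) * Real.sin 0 +
          B.eval (Real.cos 0) * Real.cos 0)) 0 :=
      ((((B.hasDerivAt _).comp (0 : ℝ) (Real.hasDerivAt_cos 0)).mul
        (Real.hasDerivAt_sin 0))).const_mul 2
    have d := (d1.sub d2).unique (d3.congr_of_eventuallyEq (.of_forall fun φ => hsub φ))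
    simp at d
    linarith
  rw [hderiv, abs_neg]
  exact abs_eval_le_of_abs_eval_cos_mul_sin_le hn (by omega) hBM (by simp)

open Polynomial in
/-- Markov's inequality on `[-1, 1]`. -/
lemma abs_eval_derivative_le_of_abs_le_one {n : ℕ} {p : ℝ[X]} (hp : p.natDegree ≤ n)
    {M : ℝ} (hM : ∀ x, |x| ≤ 1 → |p.eval x| ≤ M) {x : ℝ} (hx : |x| ≤ 1) :
    |(derivative p).eval x| ≤ M * (n : ℝ) ^ 2 := by
  rcases Nat.eq_zero_or_pos n with rfl | hn
  · rw [eq_C_of_natDegree_le_zero hp]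
    simp
  · have hdeg : (derivative p).natDegree < n :=
      (natDegree_derivative_le p).trans_lt (by omega)
    have h := abs_eval_le_of_abs_eval_cos_mul_sin_le hn hdeg
      (abs_eval_derivative_cos_mul_sin_le hn hp hM) hx
    linarith

open Polynomial in
/-- Markov's inequality on `[0, 1]`, in Lipschitz form. -/
lemma abs_eval_sub_eval_le_of_abs_le_on_Icc {n : ℕ} {p : ℝ[X]} (hp : p.natDegree ≤ n)
    {M : ℝ} (hM : ∀ x ∈ Set.Icc (0 : ℝ) 1, |p.eval x| ≤ M) {x y : ℝ}
    (hx : x ∈ Set.Icc (0 : ℝ) 1) (hy : y ∈ Set.Icc (0 : ℝ) 1) :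
    |p.eval x - p.eval y| ≤ 2 * M * (n : ℝ) ^ 2 * |x - y| := by
  have hderiv : ∀ z ∈ Set.Icc (0 : ℝ) 1, ‖(derivative p).eval z‖ ≤ 2 * M * (n : ℝ) ^ 2 := by
    intro z hz
    set P : ℝ[X] := p.comp (C (1 / 2) * X + C (1 / 2)) with hP
    have hPdeg : P.natDegree ≤ n := by
      refine (natDegree_comp_le).trans ?_
      have : (C (1 / 2 : ℝ) * X + C (1 / 2)).natDegree ≤ 1 := natDegree_linear_le
      nlinarith
    have h := abs_eval_derivative_le_of_abs_le_one hPdeg (M := M) (x := 2 * z - 1)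
      (fun t ht => ?_) (abs_le.2 ⟨by linarith [hz.1], by linarith [hz.2]⟩)
    · have he : (derivative P).eval (2 * z - 1) = 1 / 2 * (derivative p).eval z := by
        have harg : (1 / 2 : ℝ) * (2 * z - 1) + 1 / 2 = z := by ring
        rw [hP, derivative_comp]
        simp only [derivative_add, derivative_mul, derivative_C, derivative_X, eval_mul, eval_comp,
          eval_add, eval_C, eval_X, eval_one, eval_zero, harg]
        ring
      rw [he, abs_mul, abs_of_pos (by norm_num : (0 : ℝ) < 1 / 2)] at h
      rw [Real.norm_eq_abs]
      linarith
    · obtain ⟨h1, h2⟩ := abs_le.1 ht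
      rw [hP, eval_comp]
      simp only [eval_add, eval_mul, eval_C, eval_X]
      exact hM _ ⟨by linarith, by linarith⟩
  exact (convex_Icc (0 : ℝ) 1).norm_image_sub_le_of_norm_hasDerivWithin_le
    (fun z _ => (p.hasDerivAt z).hasDerivWithinAt) hderiv hy hx

theorem stmt_5 (k : ℕ) (hk : 1 ≤ k) (κ₀ κ₂ : ℝ) (hκ₀ : 1 ≤ κ₀) (hκ₂ : 0 < κ₂)
    (r : Polynomial ℝ) (hdeg : r.natDegree ≤ k)
    (hi : ∀ x ∈ Set.Icc (0:ℝ) 1, |r.eval x| ≤ κ₀)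
    (hii : ∀ x ∈ Set.Icc (0:ℝ) 1, |x * r.eval x| ≤ κ₂ / ((k : ℝ) + 1) ^ 2) :
    ∀ x ∈ Set.Icc (0:ℝ) 1, ∀ τ ∈ Set.Icc (0:ℝ) 1,
      Real.sqrt x * |r.eval x - r.eval τ| ≤
        2 * κ₀ * Real.sqrt (1 / 2 + κ₂ / κ₀) * (k : ℝ) * |x - τ| := by
  intro x hx τ hτ
  have hκ₀' : 0 < κ₀ := by linarith
  have h1 : |r.eval x - r.eval τ| ≤ 2 * κ₀ * (k : ℝ) ^ 2 * |x - τ| :=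
    abs_eval_sub_eval_le_of_abs_le_on_Icc hdeg hi hx hτ
  have h2 : |x * r.eval x - τ * r.eval τ| ≤ 2 * κ₂ * |x - τ| := by
    have hX : (Polynomial.X * r).natDegree ≤ k + 1 := by
      refine Polynomial.natDegree_mul_le.trans ?_
      rw [Polynomial.natDegree_X]
      omega
    have h := abs_eval_sub_eval_le_of_abs_le_on_Icc hX
      (fun y hy => by simpa using hii y hy) hx hτ
    simp only [Polynomial.eval_mul, Polynomial.eval_X] at h
    refine h.trans (le_of_eq ?_)
    push_cast
    field_simp
  have h3 : x * |r.eval x - r.eval τ| ≤ (2 * κ₂ + κ₀) * |x - τ| := by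
    calc x * |r.eval x - r.eval τ| = |x * (r.eval x - r.eval τ)| := by
          rw [abs_mul, abs_of_nonneg hx.1]
      _ = |(x * r.eval x - τ * r.eval τ) - (x - τ) * r.eval τ| := by congr 1; ring
      _ ≤ |x * r.eval x - τ * r.eval τ| + |(x - τ) * r.eval τ| := abs_sub _ _
      _ ≤ 2 * κ₂ * |x - τ| + |x - τ| * κ₀ := by
          rw [abs_mul (x - τ)]
          gcongr
          exact hi τ hτ
      _ = (2 * κ₂ + κ₀) * |x - τ| := by ring
  refine le_of_sq_le_sq ?_ (by positivity)
  rw [mul_pow, Real.sq_sqrt hx.1, mul_pow, mul_pow, mul_pow, Real.sq_sqrt (by positivity)]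
  calc x * |r.eval x - r.eval τ| ^ 2
        = (x * |r.eval x - r.eval τ|) * |r.eval x - r.eval τ| := by ring
    _ ≤ ((2 * κ₂ + κ₀) * |x - τ|) * (2 * κ₀ * (k : ℝ) ^ 2 * |x - τ|) := by gcongr
    _ = (2 * κ₀) ^ 2 * (1 / 2 + κ₂ / κ₀) * (k : ℝ) ^ 2 * |x - τ| ^ 2 := by
        field_simp
        ring
end

section
/- Let X be a complex Hilbert space, A and A_n bounded linear operators on X with ‖A‖ ≤ 1 and ‖A_n‖ ≤ 1. Let μ, ρ, δ, γ > 0, let v ∈ X with ‖v‖ ≤ ρ, let x† = (A*A)^{μ/2} v, f = A x†, and f_δ ∈ X with ‖f − f_δ‖ ≤ δ. Let k ≥ 1 be an integer, κ₀ ≥ 1, κ_μ > 0, and let r be a real polynomial of degree at most k with r(0) = 1 satisfying |r(λ)| ≤ κ₀ and λ^{μ/2}·|r(λ)| ≤ κ_μ/(k+1)^μ for all λ ∈ [0,1]; let g be the polynomial with r(λ) = 1 − λ·g(λ). Assume the discretization bounds ‖A*A − A_n*A_n‖ ≤ γδ/(2kρ) and ‖A_n*(A − A_n)‖ ≤ γδ/(2kρ).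 Then ‖x† − g(A_n*A_n)A_n* f_δ‖ ≤ κ_μ·ρ·k^{−μ} + 2κ₀·k·δ·(1 + γ). -/
open Polynomial

lemma sum_pow_of_odd_roots (k : ℕ) (hk : 1 ≤ k) (j : ℕ) (hj : 1 ≤ j) (hj' : j < 2 * k) :
    ∑ m ∈ Finset.range (2 * k),
      Complex.exp (((2 * m + 1) * Real.pi / (2 * k) : ℝ) * Complex.I) ^ j = 0 := by
  have hk0 : (k : ℂ) ≠ 0 := by exact_mod_cast (by omega : k ≠ 0)
  have hprim := Complex.isPrimitiveRoot_exp (2 * k) (by omega)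
  set ω := Complex.exp (2 * Real.pi * Complex.I / (2 * k : ℕ)) with hω
  have hne : ω ^ j ≠ 1 := hprim.pow_ne_one_of_pos_of_lt (by omega) hj'
  have hgeom : ∑ m ∈ Finset.range (2 * k), (ω ^ j) ^ m = 0 := by
    rw [geom_sum_eq hne, ← pow_mul, mul_comm, pow_mul, hprim.pow_eq_one]; simp
  have : ∀ m : ℕ, Complex.exp (((2 * m + 1) * Real.pi / (2 * k) : ℝ) * Complex.I) ^ j
      = Complex.exp (Real.pi / (2 * k) * Complex.I) ^ j * (ω ^ j) ^ m := by
    intro m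
    rw [hω, ← Complex.exp_nat_mul, ← Complex.exp_nat_mul, ← Complex.exp_nat_mul,
      ← Complex.exp_nat_mul, ← Complex.exp_add]
    congr 1
    push_cast
    field_simp
    ring
  simp_rw [this, ← Finset.mul_sum, hgeom, mul_zero]

/-- Moments of the weights `z / (1 - z) ^ 2` on a finite set of solutions of `z ^ (2 * k) = -1`
whose power sums vanish. -/
lemma sum_pow_div_one_sub_sq (k : ℕ) (hk : 1 ≤ k) (z : ℕ → ℂ)
    (hz : ∀ m, z m ^ (2 * k) = -1)
    (hsum : ∀ j, 1 ≤ j → j < 2 * k → ∑ m ∈ Finset.range (2 * k), z m ^ j = 0)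
    (l : ℕ) (hl : l ≤ 2 * k) :
    ∑ m ∈ Finset.range (2 * k), z m ^ (l + 1) / (1 - z m) ^ 2 = (k : ℂ) * ((l : ℂ) - k) := by
  have hne : ∀ m, 1 - z m ≠ 0 := by
    intro m h
    have h1 : z m = 1 := by linear_combination -h
    have := hz m
    rw [h1, one_pow] at this
    norm_num at this
  set S : ℕ → ℂ := fun l => ∑ m ∈ Finset.range (2 * k), z m ^ (l + 1) / (1 - z m) with hS
  set R : ℕ → ℂ := fun l => ∑ m ∈ Finset.range (2 * k), z m ^ (l + 1) / (1 - z m) ^ 2 with hR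
  have hSs : ∀ l, S (l + 1) = S l - ∑ m ∈ Finset.range (2 * k), z m ^ (l + 1) := by
    intro l
    simp only [hS]
    rw [← Finset.sum_sub_distrib]
    refine Finset.sum_congr rfl fun m _ => ?_
    have := hne m
    field_simp
    ring
  have hRs : ∀ l, R (l + 1) = R l - S l := by
    intro l
    simp only [hS, hR]
    rw [← Finset.sum_sub_distrib]
    refine Finset.sum_congr rfl fun m _ => ?_
    have := hne m
    field_simp
    ring
  have hSconst : ∀ l, l < 2 * k → S l = S 0 := by
    intro l
    induction l with
    | zero => intro _; rfl
    | succ l ih => intro h; rw [hSs, ih (by omega), hsum (l + 1) (by omega) h, sub_zero]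
  have hflip : S (2 * k) = - S 0 := by
    simp only [hS]
    rw [← Finset.sum_neg_distrib]
    refine Finset.sum_congr rfl fun m _ => ?_
    rw [pow_succ, hz]; ring
  have hRflip : R (2 * k) = - R 0 := by
    simp only [hR]
    rw [← Finset.sum_neg_distrib]
    refine Finset.sum_congr rfl fun m _ => ?_
    rw [pow_succ, hz]; ring
  have hS0 : S 0 = -k := by
    have h1 := hSs (2 * k - 1)
    rw [hSconst (2 * k - 1) (by omega), Nat.sub_add_cancel (by omega), hflip] at h1
    simp only [hz, Finset.sum_const, Finset.card_range, nsmul_eq_mul] at h1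
    push_cast at h1
    linear_combination -h1 / 2
  have hRlin : ∀ l, l ≤ 2 * k → R l = R 0 + l * k := by
    intro l
    induction l with
    | zero => intro _; simp
    | succ l ih =>
      intro h
      rw [hRs, ih (by omega), hSconst l (by omega), hS0]; push_cast; ring
  have h2 := hRlin (2 * k) le_rfl
  rw [hRflip] at h2
  push_cast at h2
  have h3 := hRlin l hl
  simp only [hR] at h3 h2 ⊢
  rw [h3]
  linear_combination -h2 / 2

/-- M. Riesz's interpolation formula: the derivative at `0` of a trigonometric polynomial of degree
at most `k` is a combination of its values with weights of total mass `k`. -/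
lemma exists_riesz_interpolation (k : ℕ) (hk : 1 ≤ k) :
    ∃ w τ : ℕ → ℝ, ∑ m ∈ Finset.range (2 * k), |w m| = k ∧
      ∀ a b : ℕ, a + b ≤ k →
        ∑ m ∈ Finset.range (2 * k), w m * (Real.cos (τ m) ^ a * Real.sin (τ m) ^ b) =
          if b = 1 then 1 else 0 := by
  have hk0 : (k : ℂ) ≠ 0 := by exact_mod_cast (by omega : k ≠ 0)
  have hk0' : (k : ℝ) ≠ 0 := by exact_mod_cast (by omega : k ≠ 0)
  set τ : ℕ → ℝ := fun m => (2 * m + 1) * Real.pi / (2 * k) with hτ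
  set z : ℕ → ℂ := fun m => Complex.exp (τ m * Complex.I) with hz
  have hzk : ∀ m, z m ^ k = Complex.I * (-1) ^ m := by
    intro m
    have : (k : ℂ) * (τ m * Complex.I) = Real.pi / 2 * Complex.I + m * (Real.pi * Complex.I) := by
      simp only [hτ]; push_cast; field_simp; ring
    simp only [hz]
    rw [← Complex.exp_nat_mul, this, Complex.exp_add, Complex.exp_pi_div_two_mul_I,
      Complex.exp_nat_mul, Complex.exp_pi_mul_I]
  have hz2k : ∀ m, z m ^ (2 * k) = -1 := by
    intro m
    rw [mul_comm, pow_mul, hzk, mul_pow, ← pow_mul, mul_comm m, pow_mul]; simp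
  have hmom := sum_pow_div_one_sub_sq k hk z hz2k
    (fun j hj hj' => sum_pow_of_odd_roots k hk j hj hj')
  have hne : ∀ m, 1 - z m ≠ 0 := by
    intro m h
    have h1 : z m = 1 := by linear_combination -h
    have := hz2k m
    rw [h1, one_pow] at this
    norm_num at this
  have hz0 : ∀ m, z m ≠ 0 := fun m => Complex.exp_ne_zero _
  have hinv : ∀ m, Complex.exp (-(τ m) * Complex.I) = (z m)⁻¹ := by
    intro m; simp only [hz]; rw [← Complex.exp_neg]; ring_nf
  have hcos : ∀ m, z m * Complex.cos (τ m) = (z m ^ 2 + 1) / 2 := by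
    intro m
    have := hz0 m
    rw [Complex.cos, hinv]
    change z m * ((z m + _) / 2) = _
    field_simp
  have hsin : ∀ m, z m * Complex.sin (τ m) = (z m ^ 2 - 1) / (2 * Complex.I) := by
    intro m
    have := hz0 m
    rw [Complex.sin, hinv]
    change z m * (((z m)⁻¹ - z m) * Complex.I / 2) = _
    field_simp
    linear_combination (1 - z m ^ 2) * Complex.I_sq
  have hker : ∀ m, z m / (1 - z m) ^ 2 = -((1 / (2 - 2 * Real.cos (τ m)) : ℝ) : ℂ) := by
    intro m
    have h0 := hz0 m
    have h1 := hne m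
    have h2 : (2 - 2 * Complex.cos (τ m)) = - (1 - z m) ^ 2 / z m := by
      rw [eq_div_iff h0]; linear_combination -2 * hcos m
    push_cast
    rw [h2]
    field_simp
  have hpos : ∀ m, 0 ≤ 1 / (2 - 2 * Real.cos (τ m)) := fun m =>
    one_div_nonneg.2 (by linarith [Real.cos_le_one (τ m)])
  refine ⟨fun m => (-1) ^ m * (1 / (2 - 2 * Real.cos (τ m))) / k, τ, ?_, ?_⟩
  · have h0 := hmom 0 (by omega)
    simp only [zero_add, pow_one, hker, Finset.sum_neg_distrib] at h0
    have h1 : ∑ m ∈ Finset.range (2 * k), (1 / (2 - 2 * Real.cos (τ m))) = (k : ℝ) * k := by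
      have : ((∑ m ∈ Finset.range (2 * k), (1 / (2 - 2 * Real.cos (τ m))) : ℝ) : ℂ)
          = ((k * k : ℝ) : ℂ) := by
        rw [Complex.ofReal_sum]; push_cast at h0 ⊢; linear_combination -h0
      exact_mod_cast this
    have habs : ∀ m : ℕ, |(-1) ^ m * (1 / (2 - 2 * Real.cos (τ m))) / k|
        = 1 / (2 - 2 * Real.cos (τ m)) / k := by
      intro m
      rw [abs_div, abs_mul, abs_of_nonneg (hpos m), Nat.abs_cast]; simp
    simp_rw [habs]
    rw [← Finset.sum_div, h1]; field_simp
  · intro a b hab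
    set q : ℂ[X] := X ^ (k - (a + b)) *
      ((C (1 / 2) * (X ^ 2 + 1)) ^ a * (C (1 / (2 * Complex.I)) * (X ^ 2 - 1)) ^ b) with hq
    have hdeg : q.natDegree < 2 * k + 1 := by
      have h1 : (C (1 / 2 : ℂ) * (X ^ 2 + 1)).natDegree ≤ 2 := by compute_degree
      have h2 : (C (1 / (2 * Complex.I)) * (X ^ 2 - 1)).natDegree ≤ 2 := by compute_degree
      have h3 := natDegree_pow_le_of_le a h1
      have h4 := natDegree_pow_le_of_le b h2
      have h5 := natDegree_mul_le_of_le (natDegree_X_pow_le (R := ℂ) (k - (a + b)))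
        (natDegree_mul_le_of_le h3 h4)
      rw [← hq] at h5
      omega
    have hqz : ∀ m, q.eval (z m) =
        z m ^ k * (Complex.cos (τ m) ^ a * Complex.sin (τ m) ^ b) := by
      intro m
      have e1 : (1 / 2 : ℂ) * (z m ^ 2 + 1) = z m * Complex.cos (τ m) := by rw [hcos]; ring
      have e2 : 1 / (2 * Complex.I) * (z m ^ 2 - 1) = z m * Complex.sin (τ m) := by
        rw [hsin]; ring
      simp only [hq, eval_mul, eval_pow, eval_X, eval_C, eval_add, eval_sub, eval_one, e1, e2]
      obtain ⟨c, rfl⟩ := Nat.exists_eq_add_of_le hab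
      rw [Nat.add_sub_cancel_left]
      ring
    have hfun : ∑ m ∈ Finset.range (2 * k), z m / (1 - z m) ^ 2 * q.eval (z m)
        = k * (q.derivative.eval 1 - k * q.eval 1) := by
      have e1 : q.derivative.eval 1 = ∑ l ∈ Finset.range (2 * k + 1), q.coeff l * l := by
        rw [derivative_eval, sum_over_range' _ (by simp) _ hdeg]; simp
      have e2 : q.eval 1 = ∑ l ∈ Finset.range (2 * k + 1), q.coeff l := by
        rw [eval_eq_sum_range' hdeg]; simp
      rw [e1, e2, Finset.mul_sum, ← Finset.sum_sub_distrib, Finset.mul_sum]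
      simp_rw [eval_eq_sum_range' hdeg, Finset.mul_sum]
      rw [Finset.sum_comm]
      refine Finset.sum_congr rfl fun l hl => ?_
      have := hmom l (by simpa [Nat.lt_succ_iff] using hl)
      calc _ = q.coeff l * ∑ m ∈ Finset.range (2 * k), z m ^ (l + 1) / (1 - z m) ^ 2 := by
            rw [Finset.mul_sum]; refine Finset.sum_congr rfl fun m _ => ?_; ring
        _ = _ := by rw [this]; ring
    have hval : q.derivative.eval 1 - k * q.eval 1 = if b = 1 then -Complex.I else 0 := by
      obtain ⟨c, hc⟩ := Nat.exists_eq_add_of_le hab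
      have hc' : k - (a + b) = c := by omega
      have hkc : (k : ℂ) = a + b + c := by exact_mod_cast hc
      rw [hq, hc', hkc]
      rcases b with _ | _ | b
      · simp [derivative_mul, derivative_pow]; norm_num; ring
      · simp [derivative_mul, derivative_pow]; norm_num
      · simp [derivative_mul, derivative_pow]
    have hterm : ∀ m, (((-1) ^ m * (1 / (2 - 2 * Real.cos (τ m))) / k *
        (Real.cos (τ m) ^ a * Real.sin (τ m) ^ b) : ℝ) : ℂ) =
        Complex.I / k * (z m / (1 - z m) ^ 2 * q.eval (z m)) := by
      intro m
      rw [hker, hqz, hzk]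
      push_cast
      linear_combination (-1) ^ m * (1 / (2 - 2 * Complex.cos (τ m))) / k *
        (Complex.cos (τ m) ^ a * Complex.sin (τ m) ^ b) * Complex.I_sq
    have : ((∑ m ∈ Finset.range (2 * k), (-1) ^ m * (1 / (2 - 2 * Real.cos (τ m))) / k *
        (Real.cos (τ m) ^ a * Real.sin (τ m) ^ b) : ℝ) : ℂ) =
        ((if b = 1 then 1 else 0 : ℝ) : ℂ) := by
      rw [Complex.ofReal_sum]
      simp_rw [hterm]
      rw [← Finset.mul_sum, hfun, hval]
      split_ifs
      · field_simp; simp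
      · simp
    exact_mod_cast this

lemma exists_pow_smul_add_smul_coeff {𝔸 : Type*} [Ring 𝔸] [Algebra ℝ 𝔸] (x y : 𝔸) (n : ℕ) :
    ∃ c : ℕ → 𝔸, ∀ t s : ℝ,
      (t • x + s • y) ^ n = ∑ b ∈ Finset.range (n + 1), (t ^ (n - b) * s ^ b) • c b := by
  induction n with
  | zero => exact ⟨fun _ => 1, fun t s => by simp⟩
  | succ n ih =>
    obtain ⟨c, hc⟩ := ih
    refine ⟨fun b => (if b ≤ n then c b * x else 0) + (if b = 0 then 0 else c (b - 1) * y),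
      fun t s => ?_⟩
    rw [pow_succ, hc, mul_add]
    simp only [smul_add, Finset.sum_add_distrib]
    congr 1
    · rw [Finset.sum_range_succ _ (n + 1), Finset.sum_mul]
      simp only [add_le_iff_nonpos_right, nonpos_iff_eq_zero, one_ne_zero, if_false, smul_zero,
        add_zero]
      refine Finset.sum_congr rfl fun b hb => ?_
      have hb' : b ≤ n := by simpa [Nat.lt_succ_iff] using hb
      rw [if_pos hb', smul_mul_smul_comm, Nat.succ_sub hb', pow_succ]
      congr 1; ring
    · rw [Finset.sum_range_succ' _ (n + 1), Finset.sum_mul]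
      simp only [if_true, smul_zero, add_zero, Nat.add_sub_cancel, Nat.succ_ne_zero, if_false]
      refine Finset.sum_congr rfl fun b _ => ?_
      rw [smul_mul_smul_comm, Nat.succ_sub_succ]
      congr 1; ring

/-- The derivative of a polynomial of degree at most `k` at `x` in the direction `y`, expressed by
values at the points `(cos τᵢ cos τⱼ) x + (sin τᵢ sin τⱼ) y`. -/
lemma hasDerivAt_aeval_add_smul {𝔸 : Type*} [NormedRing 𝔸] [NormedAlgebra ℝ 𝔸] (k N : ℕ)
    (w τ : ℕ → ℝ)
    (hw : ∀ a b : ℕ, a + b ≤ k →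
        ∑ m ∈ Finset.range N, w m * (Real.cos (τ m) ^ a * Real.sin (τ m) ^ b) =
          if b = 1 then 1 else 0)
    (p : ℝ[X]) (hp : p.natDegree ≤ k) (x y : 𝔸) :
    HasDerivAt (fun s : ℝ => aeval (x + s • y) p)
      (∑ i ∈ Finset.range N, ∑ j ∈ Finset.range N, (w i * w j) •
        aeval ((Real.cos (τ i) * Real.cos (τ j)) • x + (Real.sin (τ i) * Real.sin (τ j)) • y) p)
      0 := by
  have hmono : ∀ n ≤ k, HasDerivAt (fun s : ℝ => (x + s • y) ^ n)
      (∑ i ∈ Finset.range N, ∑ j ∈ Finset.range N, (w i * w j) •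
        ((Real.cos (τ i) * Real.cos (τ j)) • x + (Real.sin (τ i) * Real.sin (τ j)) • y) ^ n)
      0 := by
    intro n hn
    obtain ⟨c, hc⟩ := exists_pow_smul_add_smul_coeff x y n
    have h1 : (fun s : ℝ => (x + s • y) ^ n) =
        fun s : ℝ => ∑ b ∈ Finset.range (n + 1), (s ^ b) • c b := by
      funext s
      simpa using hc 1 s
    have h2 : ∑ i ∈ Finset.range N, ∑ j ∈ Finset.range N, (w i * w j) •
        ((Real.cos (τ i) * Real.cos (τ j)) • x + (Real.sin (τ i) * Real.sin (τ j)) • y) ^ n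
        = ∑ b ∈ Finset.range (n + 1), (if b = 1 then (1 : ℝ) else 0) • c b := by
      simp_rw [hc, Finset.smul_sum, smul_smul]
      rw [Finset.sum_congr rfl fun i _ => Finset.sum_comm, Finset.sum_comm]
      refine Finset.sum_congr rfl fun b hb => ?_
      have hb' : b ≤ n := by simpa [Nat.lt_succ_iff] using hb
      have h3 := hw (n - b) b (by omega)
      simp_rw [← Finset.sum_smul]
      congr 1
      calc _ = (∑ m ∈ Finset.range N, w m * (Real.cos (τ m) ^ (n - b) * Real.sin (τ m) ^ b)) *
            (∑ m ∈ Finset.range N, w m * (Real.cos (τ m) ^ (n - b) * Real.sin (τ m) ^ b)) := by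
            rw [Finset.sum_mul_sum]
            refine Finset.sum_congr rfl fun i _ => Finset.sum_congr rfl fun j _ => ?_
            ring
        _ = _ := by rw [h3]; split_ifs <;> simp
    rw [h1, h2]
    refine HasDerivAt.fun_sum fun b _ => ?_
    have h4 : HasDerivAt (fun s : ℝ => s ^ b) (if b = 1 then (1 : ℝ) else 0) 0 := by
      refine (hasDerivAt_pow b (0 : ℝ)).congr_deriv ?_
      rcases b with _ | _ | b <;> simp
    exact h4.smul_const (c b)
  have hdeg : p.natDegree < k + 1 := by omega
  simp_rw [aeval_eq_sum_range' hdeg, Finset.smul_sum]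
  rw [Finset.sum_congr rfl fun i _ => Finset.sum_comm, Finset.sum_comm]
  refine HasDerivAt.fun_sum fun n hn => ?_
  refine ((hmono n (by simpa [Nat.lt_succ_iff] using hn)).const_smul (p.coeff n)).congr_deriv ?_
  simp_rw [Finset.smul_sum]
  refine Finset.sum_congr rfl fun i _ => Finset.sum_congr rfl fun j _ => ?_
  rw [smul_comm]

lemma abs_cos_mul_cos_add_abs_sin_mul_sin_le (a b : ℝ) :
    |Real.cos a * Real.cos b| + |Real.sin a * Real.sin b| ≤ 1 := by
  have h1 := abs_le.1 (Real.abs_cos_le_one (a - b))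
  have h2 := abs_le.1 (Real.abs_cos_le_one (a + b))
  rw [Real.cos_sub] at h1
  rw [Real.cos_add] at h2
  rcases abs_cases (Real.cos a * Real.cos b) with h | h <;>
    rcases abs_cases (Real.sin a * Real.sin b) with h' | h' <;> linarith

/-- **Markov's inequality** in a normed algebra: on the unit ball of a real subspace, a polynomial
of degree at most `k` bounded by `M` there is Lipschitz with constant `k ^ 2 * M`. -/
theorem norm_aeval_sub_aeval_le {𝔸 : Type*} [NormedRing 𝔸] [NormedAlgebra ℝ 𝔸] (V : Submodule ℝ 𝔸)
    {k : ℕ} (hk : 1 ≤ k) {p : ℝ[X]} (hp : p.natDegree ≤ k) {M : ℝ}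
    (hM : ∀ z ∈ V, ‖z‖ ≤ 1 → ‖aeval z p‖ ≤ M) {x y : 𝔸} (hxV : x ∈ V) (hyV : y ∈ V)
    (hx : ‖x‖ ≤ 1) (hy : ‖y‖ ≤ 1) :
    ‖aeval x p - aeval y p‖ ≤ (k : ℝ) ^ 2 * M * ‖x - y‖ := by
  obtain ⟨w, τ, hw, hwτ⟩ := exists_riesz_interpolation k hk
  rcases eq_or_ne x y with rfl | hxy
  · simp
  have hn : 0 < ‖x - y‖ := norm_pos_iff.2 (sub_ne_zero.2 hxy)
  set u : 𝔸 := ‖x - y‖⁻¹ • (x - y) with hu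
  have huV : u ∈ V := V.smul_mem _ (V.sub_mem hxV hyV)
  have hu1 : ‖u‖ ≤ 1 := by
    rw [hu, norm_smul, norm_inv, norm_norm, inv_mul_cancel₀ hn.ne']
  have hxu : x - y = ‖x - y‖ • u := by
    rw [hu, smul_smul, mul_inv_cancel₀ hn.ne', one_smul]
  set D : 𝔸 → 𝔸 := fun z => ∑ i ∈ Finset.range (2 * k), ∑ j ∈ Finset.range (2 * k), (w i * w j) •
    aeval ((Real.cos (τ i) * Real.cos (τ j)) • z + (Real.sin (τ i) * Real.sin (τ j)) • u) p with hD
  have hDle : ∀ z ∈ V, ‖z‖ ≤ 1 → ‖D z‖ ≤ (k : ℝ) ^ 2 * M := by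
    intro z hzV hz
    calc ‖D z‖ ≤ ∑ i ∈ Finset.range (2 * k), ∑ j ∈ Finset.range (2 * k), (|w i| * |w j|) * M := by
          refine norm_sum_le_of_le _ fun i _ => norm_sum_le_of_le _ fun j _ => ?_
          rw [norm_smul, Real.norm_eq_abs, abs_mul]
          refine mul_le_mul_of_nonneg_left (hM _ ?_ ?_) (by positivity)
          · exact V.add_mem (V.smul_mem _ hzV) (V.smul_mem _ huV)
          · refine (norm_add_le _ _).trans ?_
            rw [norm_smul, norm_smul, Real.norm_eq_abs, Real.norm_eq_abs]
            exact (add_le_add (mul_le_of_le_one_right (abs_nonneg _) hz)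
              (mul_le_of_le_one_right (abs_nonneg _) hu1)).trans
              (abs_cos_mul_cos_add_abs_sin_mul_sin_le _ _)
      _ = (k : ℝ) ^ 2 * M := by
          simp_rw [← Finset.sum_mul, ← Finset.mul_sum]
          rw [← Finset.sum_mul, hw, sq]
  have hder : ∀ s : ℝ, HasDerivAt (fun s : ℝ => aeval (y + s • u) p) (D (y + s • u)) s := by
    intro s
    have h := hasDerivAt_aeval_add_smul k (2 * k) w τ hwτ p hp (y + s • u) u
    rw [← sub_self s] at h
    have h' := HasDerivAt.comp_sub_const s s h
    simpa only [add_assoc, ← add_smul, add_sub_cancel] using h'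
  have hball : ∀ s ∈ Set.Ico (0 : ℝ) ‖x - y‖, ‖y + s • u‖ ≤ 1 := by
    intro s hs
    have hconv := (convex_closedBall (0 : 𝔸) 1).add_smul_sub_mem
      (x := y) (y := x) (by simpa using hy) (by simpa using hx)
      (t := s * ‖x - y‖⁻¹)
      ⟨mul_nonneg hs.1 (by positivity), by rw [← div_eq_mul_inv, div_le_one hn]; exact hs.2.le⟩
    rw [hu, smul_smul]
    simpa using hconv
  have := norm_image_sub_le_of_norm_deriv_le_segment' (a := 0) (b := ‖x - y‖)
    (fun s _ => (hder s).hasDerivWithinAt)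
    (fun s hs => hDle _ (V.add_mem hyV (V.smul_mem _ huV)) (hball s hs)) ‖x - y‖
    ⟨hn.le, le_rfl⟩
  rw [← hxu] at this
  simpa using this

lemma norm_aeval_le_of_spectrum {𝔸 : Type*} [CStarAlgebra 𝔸] {z : 𝔸} (hz : IsSelfAdjoint z)
    {p : ℝ[X]} {M : ℝ} (hM0 : 0 ≤ M) (hM : ∀ t ∈ spectrum ℝ z, |p.eval t| ≤ M) :
    ‖aeval z p‖ ≤ M := by
  rw [← cfc_polynomial p z hz]
  exact norm_cfc_le hM0 hM

/-- The operator Markov inequality on `[0, 1]`. -/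
lemma norm_aeval_sub_aeval_le_of_spectrum {𝔸 : Type*} [CStarAlgebra 𝔸] {b c : 𝔸}
    (hb : IsSelfAdjoint b) (hc : IsSelfAdjoint c) (hbs : spectrum ℝ b ⊆ Set.Icc 0 1)
    (hcs : spectrum ℝ c ⊆ Set.Icc 0 1) {k : ℕ} (hk : 1 ≤ k) {r : ℝ[X]} (hr : r.natDegree ≤ k)
    {M : ℝ} (hM0 : 0 ≤ M) (hM : ∀ t ∈ Set.Icc (0 : ℝ) 1, |r.eval t| ≤ M) :
    ‖aeval b r - aeval c r‖ ≤ 2 * (k : ℝ) ^ 2 * M * ‖b - c‖ := by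
  set p : ℝ[X] := r.comp (C (1 / 2) * (X + 1)) with hp
  have hpdeg : p.natDegree ≤ k := by
    have h1 : (C (1 / 2 : ℝ) * (X + 1)).natDegree ≤ 1 := by compute_degree
    rw [hp, natDegree_comp]
    nlinarith
  have hbound : ∀ z ∈ selfAdjoint.submodule ℝ 𝔸, ‖z‖ ≤ 1 → ‖aeval z p‖ ≤ M := by
    intro z hz hz1
    have hz' : IsSelfAdjoint z := hz
    refine norm_aeval_le_of_spectrum hz' hM0 fun t ht => ?_
    have h1 : ‖t‖ ≤ ‖cfc (fun t : ℝ => t) z‖ := norm_apply_le_norm_cfc (fun t : ℝ => t) z ht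
    rw [cfc_id' ℝ z] at h1
    have h2 := abs_le.1 (h1.trans hz1)
    rw [hp, eval_comp]
    refine hM _ ?_
    simp only [eval_mul, eval_C, eval_add, eval_X, eval_one]
    constructor <;> linarith
  have hshift : ∀ a : 𝔸, aeval (aeval a (C 2 * X - 1 : ℝ[X])) p = aeval a r := by
    intro a
    rw [← aeval_comp, hp, comp_assoc]
    congr 1
    have : (C (1 / 2 : ℝ) * (X + 1)).comp (C 2 * X - 1) = X := by
      simp only [mul_comp, C_comp, add_comp, X_comp, one_comp, sub_add_cancel]
      rw [← mul_assoc, ← C_mul]; norm_num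
    rw [this, comp_X]
  have hsa : ∀ a : 𝔸, IsSelfAdjoint a →
      aeval a (C 2 * X - 1 : ℝ[X]) ∈ selfAdjoint.submodule ℝ 𝔸 := by
    intro a ha
    rw [← cfc_polynomial _ a ha]
    exact cfc_predicate _ a
  have hnorm : ∀ a : 𝔸, IsSelfAdjoint a → spectrum ℝ a ⊆ Set.Icc 0 1 →
      ‖aeval a (C 2 * X - 1 : ℝ[X])‖ ≤ 1 := by
    intro a ha has
    refine norm_aeval_le_of_spectrum ha zero_le_one fun t ht => ?_
    have := has ht
    simp only [eval_mul, eval_C, eval_sub, eval_X, eval_one]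
    exact abs_le.2 ⟨by linarith [this.1], by linarith [this.2]⟩
  have h := norm_aeval_sub_aeval_le (selfAdjoint.submodule ℝ 𝔸) hk hpdeg hbound
    (hsa b hb) (hsa c hc) (hnorm b hb hbs) (hnorm c hc hcs)
  rw [hshift, hshift] at h
  have hdiff : aeval b (C 2 * X - 1 : ℝ[X]) - aeval c (C 2 * X - 1 : ℝ[X])
      = (2 : ℝ) • (b - c) := by
    simp [Algebra.smul_def, mul_sub]
  rw [hdiff, norm_smul] at h
  norm_num at h
  linarith

/-- Markov's inequality for the first divided difference at `0` on `[0, 1]`. -/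
lemma abs_eval_le_of_eval_eq_one_sub_mul {k : ℕ} (hk : 1 ≤ k) {r g : ℝ[X]} (hr : r.natDegree ≤ k)
    (hrg : ∀ x : ℝ, r.eval x = 1 - x * g.eval x) {M : ℝ}
    (hM : ∀ t ∈ Set.Icc (0 : ℝ) 1, |r.eval t| ≤ M) {x : ℝ} (hx : x ∈ Set.Icc (0 : ℝ) 1) :
    |g.eval x| ≤ 2 * (k : ℝ) ^ 2 * M := by
  have hM0 : 0 ≤ M := (abs_nonneg _).trans (hM x hx)
  have hspec : ∀ t ∈ Set.Icc (0 : ℝ) 1,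
      spectrum ℝ (algebraMap ℝ ℂ t) ⊆ Set.Icc 0 1 := fun t ht => by
    rw [spectrum.scalar_eq]; simpa using ht
  have hsa : ∀ t : ℝ, IsSelfAdjoint (algebraMap ℝ ℂ t) := fun t => Complex.conj_ofReal t
  have hpos : ∀ t ∈ Set.Ioc (0 : ℝ) 1, |g.eval t| ≤ 2 * (k : ℝ) ^ 2 * M := by
    intro t ht
    have h := norm_aeval_sub_aeval_le_of_spectrum (hsa t) (hsa 0) (hspec t ⟨ht.1.le, ht.2⟩)
      (hspec 0 (by simp)) hk hr hM0 hM
    rw [aeval_algebraMap_apply, aeval_algebraMap_apply, ← map_sub, ← map_sub, norm_algebraMap',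
      norm_algebraMap', coe_aeval_eq_eval, coe_aeval_eq_eval, hrg, hrg 0, sub_zero, zero_mul,
      sub_zero, sub_sub_cancel_left, norm_neg, norm_mul, mul_comm] at h
    exact le_of_mul_le_mul_right h (norm_pos_iff.2 ht.1.ne')
  have hclosed : IsClosed {t : ℝ | |g.eval t| ≤ 2 * (k : ℝ) ^ 2 * M} :=
    isClosed_le g.continuous.abs continuous_const
  have hsub := closure_minimal (s := Set.Ioc (0 : ℝ) 1) hpos hclosed
  rw [closure_Ioc zero_ne_one] at hsub
  exact hsub hx

open ContinuousLinearMap in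
theorem stmt_7 {X : Type*} [NormedAddCommGroup X] [InnerProductSpace ℂ X] [CompleteSpace X]
    (A An : X →L[ℂ] X) (hA : ‖A‖ ≤ 1) (hAn : ‖An‖ ≤ 1)
    (μ ρ δ γ : ℝ) (hμ : 0 < μ) (hρ : 0 < ρ) (hδ : 0 < δ) (hγ : 0 < γ)
    (v : X) (hv : ‖v‖ ≤ ρ)
    (xdag : X) (hxdag : xdag = (cfc (fun t : ℝ => t ^ (μ / 2)) (adjoint A * A)) v)
    (f : X) (hf : f = A xdag)
    (fδ : X) (hfδ : ‖f - fδ‖ ≤ δ)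
    (k : ℕ) (hk : 1 ≤ k) (κ₀ κμ : ℝ) (hκ₀ : 1 ≤ κ₀) (hκμ : 0 < κμ)
    (r g : Polynomial ℝ) (hdeg : r.natDegree ≤ k) (hr0 : r.eval 0 = 1)
    (hrg : ∀ x : ℝ, r.eval x = 1 - x * g.eval x)
    (hi : ∀ x ∈ Set.Icc (0:ℝ) 1, |r.eval x| ≤ κ₀)
    (hii : ∀ x ∈ Set.Icc (0:ℝ) 1, x ^ (μ / 2) * |r.eval x| ≤ κμ / ((k : ℝ) + 1) ^ μ)
    (hd1 : ‖adjoint A * A - adjoint An * An‖ ≤ γ * δ / (2 * (k : ℝ) * ρ))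
    (hd2 : ‖adjoint An * (A - An)‖ ≤ γ * δ / (2 * (k : ℝ) * ρ)) :
    ‖xdag - (Polynomial.aeval (adjoint An * An) (g.map (algebraMap ℝ ℂ))) (adjoint An fδ)‖ ≤
      κμ * ρ * (k : ℝ) ^ (-μ) + 2 * κ₀ * (k : ℝ) * δ * (1 + γ) := by
  have hk0 : (0 : ℝ) < k := by exact_mod_cast hk
  have hsa : ∀ T : X →L[ℂ] X, IsSelfAdjoint (adjoint T * T) :=
    fun T => IsSelfAdjoint.star_mul_self T
  have hspec : ∀ T : X →L[ℂ] X, ‖T‖ ≤ 1 → spectrum ℝ (adjoint T * T) ⊆ Set.Icc 0 1 := by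
    intro T hT t ht
    have h1 : ‖t‖ ≤ ‖cfc (fun t : ℝ => t) (adjoint T * T)‖ :=
      norm_apply_le_norm_cfc (fun t : ℝ => t) (adjoint T * T) ht continuousOn_id (hsa T)
    rw [cfc_id' ℝ (adjoint T * T) (hsa T)] at h1
    have h2 : ‖adjoint T * T‖ ≤ 1 := by
      have h3 : ‖adjoint T * T‖ = ‖T‖ * ‖T‖ := CStarRing.norm_star_mul_self
      rw [h3]; exact mul_le_one₀ hT (norm_nonneg _) hT
    exact ⟨spectrum_star_mul_self_nonneg t ht, (le_abs_self t).trans (h1.trans h2)⟩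
  set B := adjoint A * A with hB
  set Bn := adjoint An * An with hBn
  have hBsa := hsa A
  have hBnsa := hsa An
  have hBs := hspec A hA
  have hBns := hspec An hAn
  rw [← hB] at hBsa hBs
  rw [← hBn] at hBnsa hBns
  have hcont : Continuous fun t : ℝ => t ^ (μ / 2) := Real.continuous_rpow_const (by positivity)
  have hg := fun x (hx : x ∈ Set.Icc (0 : ℝ) 1) =>
    abs_eval_le_of_eval_eq_one_sub_mul hk hdeg hrg hi hx
  rw [Polynomial.aeval_map_algebraMap]
  set G := aeval Bn g with hG
  have hGsa : IsSelfAdjoint G := by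
    rw [hG, ← cfc_polynomial g Bn hBnsa]; exact cfc_predicate _ _
  have hpoly : r = 1 - g * Polynomial.X := by
    refine Polynomial.funext fun x => ?_
    rw [hrg]; simp [mul_comm]
  have hrBn : aeval Bn r = 1 - G * Bn := by rw [hpoly]; simp [hG]
  have hGnorm : ‖G‖ ≤ 2 * (k : ℝ) ^ 2 * κ₀ :=
    norm_aeval_le_of_spectrum hBnsa (by positivity) fun t ht => hg t (hBns ht)
  have hGA : ‖G * adjoint An‖ ≤ 2 * k * κ₀ := by
    have h1 : ‖G * adjoint An‖ * ‖G * adjoint An‖ = ‖aeval Bn (g * (1 - r))‖ := by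
      have h2 : ‖(G * adjoint An) * star (G * adjoint An)‖
        = ‖G * adjoint An‖ * ‖G * adjoint An‖ := CStarRing.norm_self_mul_star
      have h3 : star (G * adjoint An) = An * G := by
        rw [star_mul, hGsa.star_eq]
        congr 1
        exact star_star An
      have h4 : g * (1 - r) = g * Polynomial.X * g := by rw [hpoly]; ring
      rw [← h2, h3, h4, map_mul, map_mul, aeval_X, ← hG, hBn]
      simp only [mul_assoc]
    have h4 : ‖aeval Bn (g * (1 - r))‖ ≤ (2 * k * κ₀) * (2 * k * κ₀) := by
      refine norm_aeval_le_of_spectrum hBnsa (by positivity) fun t ht => ?_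
      have h5 := hg t (hBns ht)
      have h6 := abs_le.1 (hi t (hBns ht))
      have h7 : |1 - r.eval t| ≤ 2 * κ₀ := abs_le.2 ⟨by linarith, by linarith⟩
      simp only [eval_mul, eval_sub, eval_one, abs_mul]
      calc _ ≤ 2 * (k : ℝ) ^ 2 * κ₀ * (2 * κ₀) :=
            mul_le_mul h5 h7 (abs_nonneg _) (by positivity)
        _ = _ := by ring
    rw [← h1] at h4
    exact abs_le_of_sq_le_sq' (by nlinarith) (by positivity) |>.2
  have hLip := norm_aeval_sub_aeval_le_of_spectrum hBnsa hBsa hBns hBs hk hdeg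
    (by linarith : 0 ≤ κ₀) hi
  have hxρ : ‖xdag‖ ≤ ρ := by
    rw [hxdag]
    refine (ContinuousLinearMap.le_of_opNorm_le _ (c := 1)
      (norm_cfc_le zero_le_one fun t ht => ?_) v).trans (by linarith)
    have := hBs ht
    rw [Real.norm_of_nonneg (Real.rpow_nonneg this.1 _)]
    exact Real.rpow_le_one this.1 this.2 (by positivity)
  have hmain : ‖aeval B r xdag‖ ≤ κμ * ρ * (k : ℝ) ^ (-μ) := by
    have h1 : aeval B r xdag = (cfc (fun t : ℝ => r.eval t * t ^ (μ / 2)) B) v := by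
      rw [cfc_mul (fun t => r.eval t) _ B r.continuous.continuousOn hcont.continuousOn,
        cfc_polynomial r B hBsa, hxdag]; rfl
    have hkμ : ((k : ℝ) + 1) ^ (-μ) ≤ (k : ℝ) ^ (-μ) :=
      Real.rpow_le_rpow_of_nonpos hk0 (by linarith) (by linarith)
    have h2 : ‖cfc (fun t : ℝ => r.eval t * t ^ (μ / 2)) B‖ ≤ κμ * (k : ℝ) ^ (-μ) := by
      refine norm_cfc_le (by positivity) fun t ht => ?_
      rw [norm_mul, mul_comm, Real.norm_of_nonneg (Real.rpow_nonneg (hBs ht).1 _)]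
      refine (hii t (hBs ht)).trans ?_
      rw [div_eq_mul_inv, ← Real.rpow_neg (by positivity)]
      gcongr
    rw [h1]
    calc _ ≤ κμ * (k : ℝ) ^ (-μ) * ρ := ContinuousLinearMap.le_of_opNorm_le_of_le _ h2 hv
      _ = _ := by ring
  have hdecomp : xdag - G (adjoint An fδ) = aeval B r xdag + (aeval Bn r - aeval B r) xdag
      - G ((adjoint An * (A - An)) xdag) + (G * adjoint An) (f - fδ) := by
    rw [hrBn, hf, hBn]
    simp
  have hε : 0 ≤ γ * δ / (2 * (k : ℝ) * ρ) := by positivity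
  have e1 : ‖(aeval Bn r - aeval B r) xdag‖
      ≤ 2 * (k : ℝ) ^ 2 * κ₀ * (γ * δ / (2 * (k : ℝ) * ρ)) * ρ := by
    refine ContinuousLinearMap.le_of_opNorm_le_of_le _ (hLip.trans ?_) hxρ
    rw [norm_sub_rev]
    gcongr
  have e2 : ‖G ((adjoint An * (A - An)) xdag)‖
      ≤ 2 * (k : ℝ) ^ 2 * κ₀ * ((γ * δ / (2 * (k : ℝ) * ρ)) * ρ) :=
    ContinuousLinearMap.le_of_opNorm_le_of_le _ hGnorm
      (ContinuousLinearMap.le_of_opNorm_le_of_le _ hd2 hxρ)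
  have e3 : ‖(G * adjoint An) (f - fδ)‖ ≤ 2 * k * κ₀ * δ :=
    ContinuousLinearMap.le_of_opNorm_le_of_le _ hGA hfδ
  rw [hdecomp]
  calc _ ≤ ‖aeval B r xdag‖ + ‖(aeval Bn r - aeval B r) xdag‖
        + ‖G ((adjoint An * (A - An)) xdag)‖ + ‖(G * adjoint An) (f - fδ)‖ :=
      (norm_add_le _ _).trans (by
        gcongr; exact (norm_sub_le _ _).trans (by gcongr; exact norm_add_le _ _))
    _ ≤ κμ * ρ * (k : ℝ) ^ (-μ) + 2 * (k : ℝ) ^ 2 * κ₀ * (γ * δ / (2 * (k : ℝ) * ρ)) * ρ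
        + 2 * (k : ℝ) ^ 2 * κ₀ * ((γ * δ / (2 * (k : ℝ) * ρ)) * ρ) + 2 * k * κ₀ * δ := by
      gcongr
    _ = _ := by field_simp; ring
end
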